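/- Let γ ∈ [0,1], p ∈ (1,∞), k ∈ ℝ, m(v) = ⟨v⟩^k, and θ = p/(2(p−1)). Then the function φ_{m,p,θ} defined below equals φ_{m,p,θ}(v) = (p²/(4(p−1))) k² ℓ₁(v) |v|² ⟨v⟩^{−4} − k ℓ₁(v) |v|² ⟨v⟩^{−2} + 2(γ+3)(1 − 1/p) J_γ(v), and it satisfies limsup_{|v|→∞} φ_{m,p,θ}(v) ⟨v⟩^{−γ} ≤ −2[k − (γ+3)(1 − 1/p)]. -/

import Mathlib

open MeasureTheory Real Filter

noncomputable section

abbrev E3 : Type := EuclideanSpace ℝ (Fin 3)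

/-- The standard Gaussian on ℝ³. -/
def gauss (v : E3) : ℝ :=
  (2 * π) ^ (-(3 : ℝ) / 2) * Real.exp (-‖v‖ ^ 2 / 2)

/-- `J_α(v) = ∫ |v - w|^α μ(w) dw`. -/
def Jfun (α : ℝ) (v : E3) : ℝ :=
  ∫ w : E3, ‖v - w‖ ^ α * gauss w

/-- The matrix `a_{ij}(z) = |z|^{γ+2} (δ_{ij} - z_i z_j / |z|²)` (equal to `0` at `z = 0`). -/
def amat (γ : ℝ) (z : E3) (i j : Fin 3) : ℝ :=
  ‖z‖ ^ (γ + 2) * ((if i = j then (1 : ℝ) else 0) - z i * z j / ‖z‖ ^ 2)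

/-- The entrywise convolution `ā = a * μ`. -/
def abar (γ : ℝ) (v : E3) (i j : Fin 3) : ℝ :=
  ∫ w : E3, amat γ (v - w) i j * gauss w

/-- The eigenvalue `ℓ₁(v)` of `ā(v)` in the direction `v`. -/
def ell1 (γ : ℝ) (v : E3) : ℝ :=
  ∫ w : E3, (1 - (∑ i, (v i / ‖v‖) * (w i / ‖w‖)) ^ 2) * ‖w‖ ^ (γ + 2) * gauss (v - w)

/-- Squared norm of the cross product of two vectors of ℝ³. -/
def crossSq (u w : Fin 3 → ℝ) : ℝ :=
  (u 1 * w 2 - u 2 * w 1) ^ 2 + (u 2 * w 0 - u 0 * w 2) ^ 2 + (u 0 * w 1 - u 1 * w 0) ^ 2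

/-- The eigenvalue `ℓ₂(v)` of `ā(v)` on `v^⊥`. -/
def ell2 (γ : ℝ) (v : E3) : ℝ :=
  ∫ w : E3, (1 - (1 / 2) * crossSq (fun i => v i / ‖v‖) (fun i => w i / ‖w‖)) *
    ‖w‖ ^ (γ + 2) * gauss (v - w)
/-- The partial derivative `∂_i f` in the `i`-th coordinate direction. -/
def pd (i : Fin 3) (f : E3 → ℝ) : E3 → ℝ :=
  fun v => fderiv ℝ f v (EuclideanSpace.single i 1)

/-- The weight `⟨v⟩ = (1 + |v|²)^{1/2}`. -/
def jap (v : E3) : ℝ := Real.sqrt (1 + ‖v‖ ^ 2)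

/-- `c(z) = -2 (γ+3) |z|^γ`. -/
def cfun (γ : ℝ) (z : E3) : ℝ := -2 * (γ + 3) * ‖z‖ ^ γ

/-- `b(z) = -2 |z|^γ z`. -/
def bvec (γ : ℝ) (z : E3) (i : Fin 3) : ℝ := -2 * ‖z‖ ^ γ * z i

/-- The convolution `b̄ = b * μ`. -/
def bbar (γ : ℝ) (v : E3) (i : Fin 3) : ℝ :=
  ∫ w : E3, bvec γ (v - w) i * gauss w

/-- The convolution `c̄ = c * μ`. -/
def cbar (γ : ℝ) (v : E3) : ℝ := ∫ w : E3, cfun γ (v - w) * gauss w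

def delta1 (p θ : ℝ) : ℝ := 1 - 2 * θ * (1 - 1 / p)

def delta2 (p θ : ℝ) : ℝ := delta1 p θ * (p * (1 - θ) - 1) + θ * (p - θ * (p - 1))

/-- The function `φ_{m,p,θ}`. -/
def phiW (γ p θ : ℝ) (m : E3 → ℝ) (v : E3) : ℝ :=
  delta1 p θ * (∑ i, ∑ j, abar γ v i j * pd i (pd j m) v / m v) +
  delta2 p θ * (∑ i, ∑ j, abar γ v i j * (pd i m v / m v) * (pd j m v / m v)) +
  (1 + delta1 p θ) * (∑ i, bbar γ v i * pd i m v / m v) +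
  (1 / p - 1) * cbar γ v

lemma poly_bound (r : ℝ) (hr : 0 ≤ r) : (1 + r) ^ 4 ≤ 256 * Real.exp (r ^ 2 / 4) := by
  have h1 : 1 + r ^ 2 / 8 ≤ Real.exp (r ^ 2 / 8) := by
    have := Real.add_one_le_exp (r ^ 2 / 8); linarith
  have h2 : Real.exp (r ^ 2 / 4) = Real.exp (r ^ 2 / 8) ^ 2 := by
    rw [← Real.exp_nat_mul]; congr 1; push_cast; ring
  rw [h2]
  have h3 : (1 + r) ^ 2 ≤ 16 * Real.exp (r ^ 2 / 8) := by nlinarith [sq_nonneg (r - 1)]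
  calc (1 + r) ^ 4 = ((1 + r) ^ 2) ^ 2 := by ring
    _ ≤ (16 * Real.exp (r ^ 2 / 8)) ^ 2 := by gcongr
    _ = _ := by ring

lemma gauss_nonneg (v : E3) : 0 ≤ gauss v := by unfold gauss; positivity

lemma gauss_cont : Continuous gauss := by unfold gauss; fun_prop

lemma int_exp (b : ℝ) (hb : 0 < b) : Integrable (fun w : E3 => Real.exp (-b * ‖w‖ ^ 2)) := by
  by_contra h
  have h1 := GaussianFourier.integral_rexp_neg_mul_sq_norm (V := E3) hb
  rw [integral_undef h] at h1
  have : 0 < (π / b) ^ ((Module.finrank ℝ E3 : ℝ) / 2 : ℝ) := by positivity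
  linarith

lemma int_gauss : ∫ w : E3, gauss w = 1 := by
  unfold gauss
  rw [integral_const_mul]
  have h1 := GaussianFourier.integral_rexp_neg_mul_sq_norm (V := E3) (b := 1/2) (by norm_num)
  have h2 : (fun w : E3 => Real.exp (-‖w‖ ^ 2 / 2)) = fun w : E3 => Real.exp (-(1/2) * ‖w‖ ^ 2) := by
    ext w; congr 1; ring
  rw [h2, h1]
  have : Module.finrank ℝ E3 = 3 := by simp
  rw [this]
  have e : π / (1/2) = 2 * π := by ring
  rw [e, ← Real.rpow_add (by positivity)]
  norm_num

lemma int_base : Integrable (fun w : E3 => (1 + ‖w‖) ^ 4 * gauss w) := by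
  refine Integrable.mono' ((int_exp (1/4) (by norm_num)).const_mul (256 * (2 * π) ^ (-(3 : ℝ) / 2))) ?_ ?_
  · exact (Continuous.mul (by fun_prop) gauss_cont).aestronglyMeasurable
  · refine Eventually.of_forall fun w => ?_
    have hn : 0 ≤ (1 + ‖w‖) ^ 4 * gauss w := mul_nonneg (by positivity) (gauss_nonneg w)
    rw [Real.norm_of_nonneg hn]
    have e : Real.exp (-(1/4) * ‖w‖ ^ 2) = Real.exp (‖w‖ ^ 2 / 4) * Real.exp (-‖w‖ ^ 2 / 2) := by
      rw [← Real.exp_add]; congr 1; ring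
    rw [e]; unfold gauss
    have := mul_le_mul_of_nonneg_right (poly_bound ‖w‖ (norm_nonneg w))
      (show 0 ≤ (2 * π) ^ (-(3 : ℝ) / 2) * Real.exp (-‖w‖ ^ 2 / 2) by positivity)
    linarith

lemma int_poly (v : E3) (F : E3 → ℝ) (hF : Measurable F) (C : ℝ) (hb : ∀ z, |F z| ≤ C * (1 + ‖z‖) ^ 4) :
    Integrable (fun z => F z * gauss (v - z)) := by
  have h0 := (int_base.comp_sub_left v).const_mul (C * (1 + ‖v‖) ^ 4)
  have hC : 0 ≤ C := by have := (abs_nonneg _).trans (hb 0); simpa using this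
  refine Integrable.mono' h0 ?_ ?_
  · exact (hF.mul (gauss_cont.measurable.comp (by fun_prop))).aestronglyMeasurable
  · refine Eventually.of_forall fun z => ?_
    rw [norm_mul, Real.norm_of_nonneg (gauss_nonneg _), Real.norm_eq_abs]
    have h1 : 1 + ‖z‖ ≤ (1 + ‖v‖) * (1 + ‖v - z‖) := by
      have : ‖z‖ ≤ ‖v‖ + ‖v - z‖ := by
        have := norm_sub_le v (v - z); simpa using this
      nlinarith [norm_nonneg v, norm_nonneg (v - z)]
    have h2 : (1 + ‖z‖) ^ 4 ≤ (1 + ‖v‖) ^ 4 * (1 + ‖v - z‖) ^ 4 := by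
      rw [← mul_pow]; gcongr
    calc |F z| * gauss (v - z) ≤ (C * ((1 + ‖v‖) ^ 4 * (1 + ‖v - z‖) ^ 4)) * gauss (v - z) := by
          refine mul_le_mul_of_nonneg_right ((hb z).trans ?_) (gauss_nonneg _)
          gcongr
      _ = _ := by ring

lemma meas_coord (i : Fin 3) : Measurable (fun z : E3 => z i) := by fun_prop

lemma coord_le (z : E3) (i : Fin 3) : |z i| ≤ ‖z‖ := by
  simpa using PiLp.norm_apply_le z i

lemma norm_sq3 (z : E3) : ‖z‖ ^ 2 = z 0 ^ 2 + z 1 ^ 2 + z 2 ^ 2 := by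
  rw [EuclideanSpace.real_norm_sq_eq, Fin.sum_univ_three]

/-- direction coordinates -/
def uc (z : E3) (i : Fin 3) : ℝ := z i / ‖z‖

lemma uc_le (z : E3) (i : Fin 3) : |uc z i| ≤ 1 := by
  unfold uc
  rw [abs_div, abs_norm]
  exact div_le_one_of_le₀ (coord_le z i) (norm_nonneg _)

def kd (i j : Fin 3) : ℝ := if i = j then 1 else 0

lemma kd_le (i j : Fin 3) : |kd i j| ≤ 1 := by unfold kd; split_ifs <;> simp

lemma coord_eq (z : E3) (i : Fin 3) : z i = ‖z‖ * uc z i := by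
  unfold uc
  by_cases h : z = 0
  · simp [h]
  · have : ‖z‖ ≠ 0 := by simpa using h
    field_simp

lemma amat_eq (γ : ℝ) (z : E3) (i j : Fin 3) :
    amat γ z i j = ‖z‖ ^ (γ + 2) * (kd i j - uc z i * uc z j) := by
  unfold amat uc kd; congr 2; ring

/-- the derivative of `a_ij` in direction `e_j` -/
def dA (γ : ℝ) (i j : Fin 3) (z : E3) : ℝ :=
  ‖z‖ ^ γ * (‖z‖ * ((γ + 2) * uc z j * (kd i j - uc z i * uc z j) - (kd i j * uc z j + uc z i)
    + 2 * uc z i * uc z j ^ 2))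

lemma rpow_le (γ : ℝ) (h0 : 0 ≤ γ) (h1 : γ ≤ 1) (z : E3) : ‖z‖ ^ γ ≤ 1 + ‖z‖ := by
  have hz := norm_nonneg z
  calc ‖z‖ ^ γ ≤ (1 + ‖z‖) ^ γ := by gcongr; linarith
    _ ≤ (1 + ‖z‖) ^ (1 : ℝ) := Real.rpow_le_rpow_of_exponent_le (by linarith) h1
    _ = _ := by simp

lemma rpow_add2 (γ : ℝ) (h0 : 0 ≤ γ) (z : E3) : ‖z‖ ^ (γ + 2) = ‖z‖ ^ γ * ‖z‖ ^ 2 := by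
  rw [Real.rpow_add' (norm_nonneg z) (by linarith)]; norm_num

lemma meas_uc (i : Fin 3) : Measurable (fun z : E3 => uc z i) := by
  unfold uc; exact (meas_coord i).div measurable_norm

lemma amat_meas (γ : ℝ) (i j : Fin 3) : Measurable (fun z => amat γ z i j) := by
  simp_rw [amat_eq]
  have := meas_uc i; have := meas_uc j
  fun_prop

lemma dA_meas (γ : ℝ) (i j : Fin 3) : Measurable (dA γ i j) := by
  unfold dA
  have := meas_uc i; have := meas_uc j
  fun_prop

lemma amat_bd (γ : ℝ) (h0 : 0 ≤ γ) (h1 : γ ≤ 1) (z : E3) (i j : Fin 3) :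
    |amat γ z i j| ≤ 2 * (1 + ‖z‖) ^ 3 := by
  have hz := norm_nonneg z
  rw [amat_eq, rpow_add2 γ h0, abs_mul, abs_mul, abs_of_nonneg (Real.rpow_nonneg hz γ),
    abs_of_nonneg (sq_nonneg ‖z‖)]
  have h2 : |kd i j - uc z i * uc z j| ≤ 2 := by
    have := abs_sub (kd i j) (uc z i * uc z j)
    have h3 : |uc z i * uc z j| ≤ 1 := by
      rw [abs_mul]; exact mul_le_one₀ (uc_le z i) (abs_nonneg _) (uc_le z j)
    linarith [kd_le i j]
  calc ‖z‖ ^ γ * ‖z‖ ^ 2 * |kd i j - uc z i * uc z j| ≤ (1 + ‖z‖) * (1 + ‖z‖) ^ 2 * 2 := by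
        gcongr
        · exact rpow_le γ h0 h1 z
        · linarith
    _ = _ := by ring

lemma dA_bd (γ : ℝ) (h0 : 0 ≤ γ) (h1 : γ ≤ 1) (z : E3) (i j : Fin 3) :
    |dA γ i j z| ≤ 10 * (1 + ‖z‖) ^ 4 := by
  have hz := norm_nonneg z
  unfold dA
  have hi := uc_le z i
  have hj := uc_le z j
  have hk := kd_le i j
  have hprod : ∀ a b : ℝ, |a| ≤ 1 → |b| ≤ 1 → |a * b| ≤ 1 := fun a b ha hb => by
    rw [abs_mul]; exact mul_le_one₀ ha (abs_nonneg _) hb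
  set a := uc z i
  set b := uc z j
  set d := kd i j
  have h2 : |(γ + 2) * b * (d - a * b) - (d * b + a) + 2 * a * b ^ 2| ≤ 10 := by
    have e : (γ + 2) * b * (d - a * b) - (d * b + a) + 2 * a * b ^ 2 =
      (γ + 1) * (d * b) - a - γ * (a * b * b) := by ring
    rw [e]
    have h3 := abs_le.1 (hprod d b hk hj)
    have h4 := abs_le.1 (hprod _ b (hprod a b hi hj) hj)
    have h5 := abs_le.1 hi
    rw [abs_le]; constructor <;> nlinarith
  rw [abs_mul, abs_mul, abs_of_nonneg (Real.rpow_nonneg hz γ), abs_of_nonneg hz]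
  calc ‖z‖ ^ γ * (‖z‖ * |(γ + 2) * b * (d - a * b) - (d * b + a) + 2 * a * b ^ 2|)
      ≤ (1 + ‖z‖) * ((1 + ‖z‖) * 10) := by
        gcongr
        · exact rpow_le γ h0 h1 z
        · linarith
    _ = 10 * (1 + ‖z‖) ^ 2 := by ring
    _ ≤ _ := by
      gcongr
      · linarith
      · norm_num

lemma hasLine_coord (x : E3) (i j : Fin 3) :
    HasDerivAt (fun t : ℝ => (x + t • EuclideanSpace.single j (1 : ℝ) : E3) i) (kd i j) 0 := by
  have h : (fun t : ℝ => (x + t • EuclideanSpace.single j (1 : ℝ) : E3) i) = fun t => x i + t * kd i j := by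
    ext t; simp [kd]
  rw [h]
  simpa using ((hasDerivAt_id (0 : ℝ)).mul_const (kd i j)).const_add (x i)

lemma hasLine_normsq (x : E3) (j : Fin 3) :
    HasDerivAt (fun t : ℝ => ‖(x + t • EuclideanSpace.single j (1 : ℝ) : E3)‖ ^ 2) (2 * x j) 0 := by
  have h := ((hasStrictFDerivAt_norm_sq x).hasFDerivAt).hasLineDerivAt (EuclideanSpace.single j (1 : ℝ))
  unfold HasLineDerivAt at h
  refine HasDerivAt.congr_deriv h ?_
  simp [EuclideanSpace.inner_single_right]

lemma hasLine_rpow (γ : ℝ) (h0 : 0 ≤ γ) (x : E3) (j : Fin 3) :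
    HasDerivAt (fun t : ℝ => ‖(x + t • EuclideanSpace.single j (1 : ℝ) : E3)‖ ^ (γ + 2))
      ((γ + 2) * ‖x‖ ^ γ * x j) 0 := by
  have h := (hasFDerivAt_norm_rpow x (p := γ + 2) (by linarith)).hasLineDerivAt
    (EuclideanSpace.single j (1 : ℝ))
  unfold HasLineDerivAt at h
  refine HasDerivAt.congr_deriv h ?_
  simp [EuclideanSpace.inner_single_right]

lemma amat_line (γ : ℝ) (h0 : 0 ≤ γ) (i j : Fin 3) (x : E3) :
    HasLineDerivAt ℝ (fun z => amat γ z i j) (dA γ i j x) x (EuclideanSpace.single j 1) := by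
  unfold HasLineDerivAt
  by_cases hx : x = 0
  · subst hx
    have h : (fun t : ℝ => amat γ ((0 : E3) + t • EuclideanSpace.single j (1 : ℝ)) i j) = fun _ => 0 := by
      ext t
      unfold amat
      by_cases ht : t = 0
      · subst ht
        simp [Real.zero_rpow (show γ + 2 ≠ 0 by linarith)]
      · by_cases hij : i = j
        · subst hij
          simp [norm_smul]
          right
          field_simp
          ring
        · simp [hij]
    rw [h]
    have : dA γ i j 0 = 0 := by simp [dA]
    rw [this]
    exact hasDerivAt_const _ _
  · have hn : ‖x‖ ≠ 0 := by simpa using hx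
    have hq : ‖(x + (0 : ℝ) • EuclideanSpace.single j (1 : ℝ) : E3)‖ ^ 2 ≠ 0 := by simpa using hx
    have h := (hasLine_rpow γ h0 x j).mul ((((hasLine_coord x i j).mul (hasLine_coord x j j)).div
      (hasLine_normsq x j) hq).const_sub (if i = j then (1 : ℝ) else 0))
    unfold amat
    refine HasDerivAt.congr_deriv h ?_
    simp only [zero_smul, add_zero, Pi.mul_apply, Pi.div_apply]
    rw [rpow_add2 γ h0]
    have hk : (if i = j then (1 : ℝ) else 0) = kd i j := rfl
    have hkj : kd j j = 1 := by simp [kd]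
    unfold dA uc
    rw [hk, hkj]
    field_simp
    ring

lemma gauss_line (v x : E3) (j : Fin 3) :
    HasLineDerivAt ℝ (fun z => gauss (v - z)) ((v j - x j) * gauss (v - x)) x
      (EuclideanSpace.single j 1) := by
  unfold HasLineDerivAt gauss
  have h1 : HasDerivAt (fun t : ℝ => ‖v - (x + t • EuclideanSpace.single j (1 : ℝ) : E3)‖ ^ 2)
      (-2 * (v j - x j)) 0 := by
    have h := (hasLine_normsq (x - v) j)
    have e : (fun t : ℝ => ‖v - (x + t • EuclideanSpace.single j (1 : ℝ) : E3)‖ ^ 2) =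
      fun t : ℝ => ‖(x - v + t • EuclideanSpace.single j (1 : ℝ) : E3)‖ ^ 2 := by
      ext t; rw [← norm_neg]; congr 2; abel
    rw [e]; convert h using 1; simp; ring
  have h2 := (((h1.neg).div_const 2).exp).const_mul ((2 * π) ^ (-(3 : ℝ) / 2))
  refine HasDerivAt.congr_deriv h2 ?_
  simp
  ring

lemma amat_meas_int (γ : ℝ) (h0 : 0 ≤ γ) (h1 : γ ≤ 1) (v : E3) (i j : Fin 3) :
    Integrable (fun z => amat γ z i j * gauss (v - z)) :=
  int_poly v _ (amat_meas γ i j) 2 fun z => (amat_bd γ h0 h1 z i j).trans (by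
    gcongr
    · linarith [norm_nonneg z]
    · norm_num)

lemma amat_int' (γ : ℝ) (h0 : 0 ≤ γ) (h1 : γ ≤ 1) (v : E3) (i j l : Fin 3) :
    Integrable (fun z => amat γ z i j * z l * gauss (v - z)) := by
  refine int_poly v _ ((amat_meas γ i j).mul (meas_coord l)) 2 fun z => ?_
  rw [abs_mul]
  calc |amat γ z i j| * |z l| ≤ 2 * (1 + ‖z‖) ^ 3 * (1 + ‖z‖) := by
        gcongr
        · exact amat_bd γ h0 h1 z i j
        · linarith [coord_le z l]
    _ = _ := by ring

lemma ibp (γ : ℝ) (h0 : 0 ≤ γ) (h1 : γ ≤ 1) (v : E3) (i j : Fin 3) :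
    ∫ z, amat γ z i j * ((v j - z j) * gauss (v - z)) = -∫ z, dA γ i j z * gauss (v - z) := by
  refine integral_bilinear_hasLineDerivAt_right_eq_neg_left_of_integrable
    (B := ContinuousLinearMap.mul ℝ ℝ) (v := EuclideanSpace.single j 1) ?_ ?_ ?_ ?_ ?_
  · exact int_poly v _ (dA_meas γ i j) 10 fun z => dA_bd γ h0 h1 z i j
  · refine (((amat_meas_int γ h0 h1 v i j).const_mul (v j)).sub (amat_int' γ h0 h1 v i j j)).congr
      (Eventually.of_forall fun z => ?_)
    simp; ring
  · exact amat_meas_int γ h0 h1 v i j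
  · exact fun x _ => amat_line γ h0 i j x
  · exact fun x _ => gauss_line v x j

lemma abar_eq (γ : ℝ) (v : E3) (i j : Fin 3) :
    abar γ v i j = ∫ z, amat γ z i j * gauss (v - z) := by
  unfold abar
  rw [← integral_sub_left_eq_self _ volume v]
  simp

lemma bbar_eq (γ : ℝ) (v : E3) (i : Fin 3) :
    bbar γ v i = ∫ z, bvec γ z i * gauss (v - z) := by
  unfold bbar
  rw [← integral_sub_left_eq_self _ volume v]
  simp

lemma uc_sq (z : E3) (hz : z ≠ 0) : uc z 0 ^ 2 + uc z 1 ^ 2 + uc z 2 ^ 2 = 1 := by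
  have hn : ‖z‖ ≠ 0 := by simpa using hz
  unfold uc; field_simp; rw [norm_sq3]

lemma sum_dA (γ : ℝ) (i : Fin 3) (z : E3) : ∑ j, dA γ i j z = bvec γ z i := by
  by_cases hz : z = 0
  · simp [hz, dA, bvec]
  have h := uc_sq z hz
  unfold bvec
  rw [coord_eq z i, Fin.sum_univ_three]
  unfold dA
  have e : ∀ j, kd i j * uc z j = kd i j * uc z i := fun j => by
    unfold kd; split_ifs with hh
    · rw [hh]
    · simp
  have e1 : kd i 0 + kd i 1 + kd i 2 = 1 := by fin_cases i <;> simp [kd]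
  have e0 := e 0; have e2 := e 1; have e3 := e 2
  have : (γ + 1) * (kd i 0 * uc z 0 + kd i 1 * uc z 1 + kd i 2 * uc z 2) - 3 * uc z i
     - γ * uc z i * (uc z 0 ^ 2 + uc z 1 ^ 2 + uc z 2 ^ 2) = - 2 * uc z i := by
    rw [h, e0, e2, e3]; linear_combination (γ + 1) * uc z i * e1
  linear_combination ‖z‖ ^ γ * ‖z‖ * this

lemma sum_amat (γ : ℝ) (i : Fin 3) (z : E3) : ∑ j, amat γ z i j * z j = 0 := by
  by_cases hz : z = 0
  · simp [hz]
  have h := uc_sq z hz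
  simp only [amat_eq, coord_eq z]
  rw [Fin.sum_univ_three]
  have e : kd i 0 * uc z 0 + kd i 1 * uc z 1 + kd i 2 * uc z 2 = uc z i := by fin_cases i <;> simp [kd]
  have : ∀ (N M : ℝ), N * (kd i 0 - uc z i * uc z 0) * (M * uc z 0) +
    N * (kd i 1 - uc z i * uc z 1) * (M * uc z 1) +
    N * (kd i 2 - uc z i * uc z 2) * (M * uc z 2) = 0 := by
    intro N M
    linear_combination N * M * e - N * M * uc z i * h
  exact this _ _

lemma bbar_abar (γ : ℝ) (h0 : 0 ≤ γ) (h1 : γ ≤ 1) (v : E3) (i : Fin 3) :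
    bbar γ v i = - ∑ j, abar γ v i j * v j := by
  have hd : ∀ j ∈ Finset.univ, Integrable (fun z => dA γ i j z * gauss (v - z)) := fun j _ =>
    int_poly v _ (dA_meas γ i j) 10 fun z => dA_bd γ h0 h1 z i j
  have e1 : bbar γ v i = ∑ j, ∫ z, dA γ i j z * gauss (v - z) := by
    rw [bbar_eq, ← integral_finsetSum _ hd]
    congr 1; ext z
    rw [← Finset.sum_mul, sum_dA]
  have e2 : ∀ j, ∫ z, dA γ i j z * gauss (v - z) =
      - (abar γ v i j * v j) + ∫ z, amat γ z i j * z j * gauss (v - z) := by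
    intro j
    have h := ibp γ h0 h1 v i j
    have h' : ∫ z, amat γ z i j * ((v j - z j) * gauss (v - z)) =
       abar γ v i j * v j - ∫ z, amat γ z i j * z j * gauss (v - z) := by
      rw [abar_eq, ← integral_mul_const, ← integral_sub ((amat_meas_int γ h0 h1 v i j).mul_const _)
        (amat_int' γ h0 h1 v i j j)]
      congr 1; ext z; ring
    linarith
  rw [e1]
  simp_rw [e2]
  rw [Finset.sum_add_distrib, ← integral_finsetSum _ (fun j _ => amat_int' γ h0 h1 v i j j)]
  simp_rw [← Finset.sum_mul, sum_amat γ i]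
  simp

lemma ell1_eq (γ : ℝ) (h0 : 0 ≤ γ) (h1 : γ ≤ 1) (v : E3) :
    ∑ i, ∑ j, abar γ v i j * v i * v j = ell1 γ v * ‖v‖ ^ 2 := by
  by_cases hv : v = 0
  · simp [hv]
  have e : ∑ i, ∑ j, abar γ v i j * v i * v j =
      ∫ z, ∑ i, ∑ j, amat γ z i j * gauss (v - z) * v i * v j := by
    rw [integral_finsetSum _ fun i _ => integrable_finsetSum _ fun j _ =>
      ((amat_meas_int γ h0 h1 v i j).mul_const _).mul_const _]
    refine Finset.sum_congr rfl fun i _ => ?_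
    rw [integral_finsetSum _ fun j _ =>
      ((amat_meas_int γ h0 h1 v i j).mul_const _).mul_const _]
    refine Finset.sum_congr rfl fun j _ => ?_
    rw [abar_eq, integral_mul_const, integral_mul_const]
  rw [e, ell1, ← integral_mul_const]
  congr 1; ext z
  have h := uc_sq v hv
  have e2 : (∑ i, v i / ‖v‖ * (z i / ‖z‖)) = uc v 0 * uc z 0 + uc v 1 * uc z 1 + uc v 2 * uc z 2 := by
    rw [Fin.sum_univ_three]; rfl
  rw [e2]
  simp only [amat_eq, coord_eq v, Fin.sum_univ_three]
  simp [kd]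
  linear_combination ‖z‖ ^ (γ + 2) * gauss (v - z) * ‖v‖ ^ 2 * h

lemma jap_pos (v : E3) : 0 < jap v := by unfold jap; positivity

lemma jap_sq (v : E3) : jap v ^ 2 = 1 + ‖v‖ ^ 2 := by
  unfold jap; exact Real.sq_sqrt (by positivity)

lemma jap_rpow (v : E3) (k : ℝ) : jap v ^ k = (1 + ‖v‖ ^ 2) ^ (k / 2) := by
  rw [← jap_sq, ← Real.rpow_natCast_mul (jap_pos v).le]; congr 1; push_cast; ring

lemma pd_jap (k : ℝ) (v : E3) (i : Fin 3) :
    pd i (fun v => jap v ^ k) v / jap v ^ k = k * v i * jap v ^ (-(2 : ℝ)) := by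
  have h := (((hasStrictFDerivAt_norm_sq v).hasFDerivAt).const_add 1).rpow_const (p := k / 2)
      (Or.inl (by positivity))
  have hf : (fun v : E3 => jap v ^ k) = fun v : E3 => (1 + ‖v‖ ^ 2) ^ (k / 2) := by
    ext v; exact jap_rpow v k
  unfold pd
  rw [hf, h.fderiv]
  have hp := jap_pos v
  have e : (1 + ‖v‖ ^ 2) ^ (k / 2 - 1) = jap v ^ k * jap v ^ (-(2:ℝ)) := by
    rw [← Real.rpow_add hp, jap_rpow]; congr 1; ring
  simp [EuclideanSpace.inner_single_right]
  rw [e]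
  have : jap v ^ k ≠ 0 := by positivity
  simp; field_simp

lemma phi_formula (γ : ℝ) (hγ0 : 0 ≤ γ) (hγ1 : γ ≤ 1) (p : ℝ) (hp : 1 < p) (k : ℝ) (v : E3) :
    phiW γ p (p / (2 * (p - 1))) (fun v => jap v ^ k) v =
      (p ^ 2 / (4 * (p - 1))) * k ^ 2 * ell1 γ v * ‖v‖ ^ 2 * jap v ^ (-(4 : ℝ)) -
        k * ell1 γ v * ‖v‖ ^ 2 * jap v ^ (-(2 : ℝ)) +
        2 * (γ + 3) * (1 - 1 / p) * Jfun γ v := by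
  have hp1 : p - 1 ≠ 0 := by linarith
  have hp0 : p ≠ 0 := by linarith
  have d1 : delta1 p (p / (2 * (p - 1))) = 0 := by
    unfold delta1; field_simp; ring
  have d2 : delta2 p (p / (2 * (p - 1))) = p ^ 2 / (4 * (p - 1)) := by
    unfold delta2; rw [d1]; field_simp; ring
  have hc : cbar γ v = -2 * (γ + 3) * Jfun γ v := by
    unfold cbar Jfun cfun
    rw [← integral_const_mul]; congr 1; ext w; ring
  have h4 : jap v ^ (-(4 : ℝ)) = jap v ^ (-(2 : ℝ)) * jap v ^ (-(2 : ℝ)) := by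
    rw [← Real.rpow_add (jap_pos v)]; norm_num
  unfold phiW
  rw [d1, d2, hc]
  simp_rw [mul_div_assoc, pd_jap, bbar_abar γ hγ0 hγ1]
  have hl := ell1_eq γ hγ0 hγ1 v
  rw [h4]
  simp only [Fin.sum_univ_three] at hl ⊢
  linear_combination (p ^ 2 / (4 * (p - 1)) * k ^ 2 * jap v ^ (-(2 : ℝ)) * jap v ^ (-(2 : ℝ)) -
    k * jap v ^ (-(2 : ℝ))) * hl

lemma jap_ge (v : E3) : ‖v‖ ≤ jap v := by
  unfold jap; exact Real.le_sqrt_of_sq_le (by linarith)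

lemma jap_ge_one (v : E3) : 1 ≤ jap v := by
  unfold jap; exact Real.le_sqrt_of_sq_le (by nlinarith [norm_nonneg v])

lemma jap_le (v : E3) : jap v ≤ 1 + ‖v‖ := by
  unfold jap; exact Real.sqrt_le_iff.2 ⟨by positivity, by nlinarith [norm_nonneg v]⟩

lemma jap_cont : Continuous jap := by unfold jap; fun_prop

lemma jap_tendsto : Tendsto jap (comap (fun v : E3 => ‖v‖) atTop) atTop :=
  tendsto_atTop_mono jap_ge tendsto_comap

lemma err_tendsto (C : ℝ) :
    Tendsto (fun v : E3 => C / jap v) (comap (fun v : E3 => ‖v‖) atTop) (nhds 0) :=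
  jap_tendsto.const_div_atTop C

lemma ratio_near (v w : E3) : |‖v - w‖ / jap v - 1| ≤ (1 + ‖w‖) / jap v := by
  have hp := jap_pos v
  have e : ‖v - w‖ / jap v - 1 = (‖v - w‖ - jap v) / jap v := by field_simp
  rw [e, abs_div, abs_of_pos hp]
  gcongr
  have h1 := norm_sub_le v w
  have h2 := norm_sub_norm_le v w
  have h3 := jap_ge v
  have h4 := jap_le v
  rw [abs_le]; constructor <;> linarith

lemma ratio_le (v w : E3) : ‖v - w‖ / jap v ≤ 1 + ‖w‖ := by
  have hp := jap_pos v
  rw [div_le_iff₀ hp]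
  have h1 := norm_sub_le v w
  nlinarith [jap_ge v, jap_ge_one v, norm_nonneg w]

/-- normalised scalar product -/
def sp (v w : E3) : ℝ := (∑ i, (v i - w i) * v i) / jap v ^ 2

lemma sp_near (v w : E3) : |sp v w - 1| ≤ (1 + ‖w‖) / jap v := by
  have hp := jap_pos v
  have h1 := jap_ge_one v
  have hin : (∑ i, w i * v i) = inner ℝ w v := by
    simp [PiLp.inner_apply, mul_comm]
  have hs : (∑ i, (v i - w i) * v i) = ‖v‖ ^ 2 - inner ℝ w v := by
    rw [← hin, norm_sq3]; simp only [Fin.sum_univ_three]; ring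
  have e : sp v w - 1 = (-1 - inner ℝ w v) / jap v ^ 2 := by
    unfold sp; rw [hs]; field_simp; rw [jap_sq]; ring
  rw [e, abs_div, abs_of_pos (by positivity : 0 < jap v ^ 2), div_le_div_iff₀ (by positivity) hp]
  have h2 := abs_le.1 (abs_real_inner_le_norm w v)
  have h3 : |-1 - inner ℝ w v| ≤ 1 + ‖w‖ * ‖v‖ := by
    rw [abs_le]; constructor <;> linarith
  have h4 : |-1 - inner ℝ w v| ≤ (1 + ‖w‖) * jap v := by
    nlinarith [jap_ge v, norm_nonneg w]
  calc |-1 - inner ℝ w v| * jap v ≤ (1 + ‖w‖) * jap v * jap v := by gcongr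
    _ = _ := by ring

lemma sp_le (v w : E3) : |sp v w| ≤ 2 * (1 + ‖w‖) := by
  have h := sp_near v w
  have h2 : (1 + ‖w‖) / jap v ≤ 1 + ‖w‖ := div_le_self (by positivity) (jap_ge_one v)
  rw [abs_le] at *
  constructor <;> linarith [norm_nonneg w]

lemma tendsto_of_near (f : E3 → ℝ) (C : ℝ) (h : ∀ v, |f v - 1| ≤ C / jap v) :
    Tendsto f (comap (fun v : E3 => ‖v‖) atTop) (nhds 1) := by
  rw [tendsto_iff_norm_sub_tendsto_zero]
  exact squeeze_zero (fun _ => norm_nonneg _) h (err_tendsto C)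

lemma ratio_rpow_tendsto (γ : ℝ) (w : E3) :
    Tendsto (fun v : E3 => (‖v - w‖ / jap v) ^ γ) (comap (fun v : E3 => ‖v‖) atTop) (nhds 1) := by
  have := (tendsto_of_near _ _ (fun v => ratio_near v w)).rpow_const (p := γ) (Or.inl one_ne_zero)
  simpa using this

lemma ratio_rpow_le (γ : ℝ) (h0 : 0 ≤ γ) (h1 : γ ≤ 1) (v w : E3) :
    (‖v - w‖ / jap v) ^ γ ≤ 1 + ‖w‖ := by
  have hp := jap_pos v
  calc (‖v - w‖ / jap v) ^ γ ≤ (1 + ‖w‖) ^ γ := by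
        gcongr; exact ratio_le v w
    _ ≤ (1 + ‖w‖) ^ (1 : ℝ) := Real.rpow_le_rpow_of_exponent_le (by linarith [norm_nonneg w]) h1
    _ = _ := by simp

lemma ratio_split (γ : ℝ) (v w : E3) :
    (‖v - w‖ / jap v) ^ γ = ‖v - w‖ ^ γ * jap v ^ (-γ) := by
  rw [Real.div_rpow (norm_nonneg _) (jap_pos v).le, Real.rpow_neg (jap_pos v).le]; rfl

lemma J_tendsto (γ : ℝ) (h0 : 0 ≤ γ) (h1 : γ ≤ 1) :
    Tendsto (fun v : E3 => Jfun γ v * jap v ^ (-γ)) (comap (fun v : E3 => ‖v‖) atTop) (nhds 1) := by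
  have e : (fun v : E3 => Jfun γ v * jap v ^ (-γ)) =
      fun v => ∫ w, (‖v - w‖ / jap v) ^ γ * gauss w := by
    ext v
    unfold Jfun
    rw [← integral_mul_const]
    congr 1; ext w; rw [ratio_split]; ring
  rw [e, ← int_gauss]
  refine tendsto_integral_filter_of_dominated_convergence (fun w => (1 + ‖w‖) ^ 4 * gauss w)
    ?_ ?_ int_base ?_
  · refine Eventually.of_forall fun v => ?_
    have := gauss_cont.measurable
    exact Measurable.aestronglyMeasurable (by fun_prop)
  · refine Eventually.of_forall fun v => Eventually.of_forall fun w => ?_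
    have hp := jap_pos v
    rw [norm_mul, Real.norm_of_nonneg (gauss_nonneg w), Real.norm_of_nonneg (by positivity)]
    refine mul_le_mul_of_nonneg_right ((ratio_rpow_le γ h0 h1 v w).trans ?_) (gauss_nonneg w)
    exact le_self_pow₀ (by linarith [norm_nonneg w]) (by norm_num)
  · refine Eventually.of_forall fun w => ?_
    simpa using (ratio_rpow_tendsto γ w).mul_const (gauss w)

lemma B_formula (γ : ℝ) (h0 : 0 ≤ γ) (h1 : γ ≤ 1) (v : E3) :
    ell1 γ v * ‖v‖ ^ 2 = ∫ w, 2 * ‖v - w‖ ^ γ * (∑ i, (v i - w i) * v i) * gauss w := by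
  have hb : ∀ i ∈ Finset.univ, Integrable (fun z => bvec γ z i * gauss (v - z) * (-v i)) := fun i _ => by
    refine Integrable.mul_const ?_ _
    refine int_poly v (fun z => bvec γ z i) ?_ 2 fun z => ?_
    · have := meas_coord i
      unfold bvec; fun_prop
    · unfold bvec
      have hz := norm_nonneg z
      rw [abs_mul, abs_mul, abs_of_nonneg (Real.rpow_nonneg hz γ)]
      norm_num
      calc 2 * ‖z‖ ^ γ * |z i| ≤ 2 * (1 + ‖z‖) * (1 + ‖z‖) := by
            gcongr
            · exact rpow_le γ h0 h1 z
            · linarith [coord_le z i]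
        _ = 2 * (1 + ‖z‖) ^ 2 := by ring
        _ ≤ _ := by
          gcongr
          · linarith
          · norm_num
  have e1 : ell1 γ v * ‖v‖ ^ 2 = ∑ i, bbar γ v i * (-v i) := by
    rw [← ell1_eq γ h0 h1 v]
    refine Finset.sum_congr rfl fun i _ => ?_
    rw [bbar_abar γ h0 h1, neg_mul_neg, Finset.sum_mul]
    exact Finset.sum_congr rfl fun j _ => by ring
  rw [e1]
  simp_rw [bbar_eq, ← integral_mul_const]
  rw [← integral_finsetSum _ hb, ← integral_sub_left_eq_self _ volume v]
  congr 1; ext w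
  simp only [bvec, Fin.sum_univ_three, sub_sub_cancel, PiLp.sub_apply]
  ring

lemma B_tendsto (γ : ℝ) (h0 : 0 ≤ γ) (h1 : γ ≤ 1) :
    Tendsto (fun v : E3 => ell1 γ v * ‖v‖ ^ 2 * jap v ^ (-(2 : ℝ)) * jap v ^ (-γ))
      (comap (fun v : E3 => ‖v‖) atTop) (nhds 2) := by
  have e : (fun v : E3 => ell1 γ v * ‖v‖ ^ 2 * jap v ^ (-(2 : ℝ)) * jap v ^ (-γ)) =
      fun v => ∫ w, 2 * (‖v - w‖ / jap v) ^ γ * sp v w * gauss w := by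
    ext v
    rw [B_formula γ h0 h1, ← integral_mul_const, ← integral_mul_const]
    have h2 : jap v ^ (-(2 : ℝ)) = (jap v ^ 2)⁻¹ := by
      rw [Real.rpow_neg (jap_pos v).le]; norm_num
    congr 1; ext w; rw [ratio_split, sp, h2]; ring
  have e2 : (2 : ℝ) = ∫ w : E3, 2 * gauss w := by rw [integral_const_mul, int_gauss]; norm_num
  rw [e]
  rw [show nhds (2 : ℝ) = nhds (∫ w : E3, 2 * gauss w) from congrArg nhds e2]
  refine tendsto_integral_filter_of_dominated_convergence (fun w => 4 * ((1 + ‖w‖) ^ 4 * gauss w))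
    ?_ ?_ (int_base.const_mul 4) ?_
  · refine Eventually.of_forall fun v => ?_
    have := gauss_cont.measurable
    have := meas_coord
    unfold sp
    exact Measurable.aestronglyMeasurable (by fun_prop)
  · refine Eventually.of_forall fun v => Eventually.of_forall fun w => ?_
    have hp := jap_pos v
    have hw := norm_nonneg w
    rw [norm_mul, Real.norm_of_nonneg (gauss_nonneg w), ← mul_assoc]
    refine mul_le_mul_of_nonneg_right ?_ (gauss_nonneg w)
    rw [norm_mul, norm_mul, Real.norm_of_nonneg (by positivity : 0 ≤ (‖v - w‖ / jap v) ^ γ),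
      Real.norm_eq_abs, Real.norm_eq_abs, abs_of_pos (by norm_num : (0:ℝ) < 2)]
    calc 2 * (‖v - w‖ / jap v) ^ γ * |sp v w| ≤ 2 * (1 + ‖w‖) * (2 * (1 + ‖w‖)) := by
          gcongr
          · exact ratio_rpow_le γ h0 h1 v w
          · exact sp_le v w
      _ = 4 * (1 + ‖w‖) ^ 2 := by ring
      _ ≤ _ := by
          gcongr
          · linarith
          · norm_num
  · refine Eventually.of_forall fun w => ?_
    have := (((ratio_rpow_tendsto γ w).const_mul 2).mul
      (tendsto_of_near _ _ (fun v => sp_near v w))).mul_const (gauss w)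
    simpa using this

/-- For `m = ⟨v⟩^k`, `p ∈ (1,∞)` and `θ = p/(2(p-1))`: the explicit formula for
`φ_{m,p,θ}` and `limsup_{|v|→∞} φ_{m,p,θ}(v) ⟨v⟩^{-γ} ≤ -2[k - (γ+3)(1-1/p)]`. -/
theorem stmt16 (γ : ℝ) (hγ0 : 0 ≤ γ) (hγ1 : γ ≤ 1) (p : ℝ) (hp : 1 < p) (k : ℝ) :
    (∀ v : E3, phiW γ p (p / (2 * (p - 1))) (fun v => jap v ^ k) v =
      (p ^ 2 / (4 * (p - 1))) * k ^ 2 * ell1 γ v * ‖v‖ ^ 2 * jap v ^ (-(4 : ℝ)) -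
        k * ell1 γ v * ‖v‖ ^ 2 * jap v ^ (-(2 : ℝ)) +
        2 * (γ + 3) * (1 - 1 / p) * Jfun γ v) ∧
    limsup (fun v : E3 => phiW γ p (p / (2 * (p - 1))) (fun v => jap v ^ k) v * jap v ^ (-γ))
        (comap (fun v : E3 => ‖v‖) atTop) ≤
      -2 * (k - (γ + 3) * (1 - 1 / p)) := by

  refine ⟨phi_formula γ hγ0 hγ1 p hp k, ?_⟩
  have hne : (comap (fun v : E3 => ‖v‖) atTop).NeBot := by
    rw [comap_norm_atTop]; infer_instance
  have hB := B_tendsto γ hγ0 hγ1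
  have hJ := J_tendsto γ hγ0 hγ1
  have hz : Tendsto (fun v : E3 => jap v ^ (-(2 : ℝ))) (comap (fun v : E3 => ‖v‖) atTop) (nhds 0) :=
    (tendsto_rpow_neg_atTop (by norm_num : (0 : ℝ) < 2)).comp jap_tendsto
  have hT := (((hB.mul hz).const_mul (p ^ 2 / (4 * (p - 1)) * k ^ 2)).sub (hB.const_mul k)).add
    (hJ.const_mul (2 * (γ + 3) * (1 - 1 / p)))
  refine le_of_eq (Tendsto.limsup_eq ?_)
  refine (hT.congr fun v => ?_).trans_eq ?_
  · rw [phi_formula γ hγ0 hγ1 p hp k v]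
    have h4 : jap v ^ (-(4 : ℝ)) = jap v ^ (-(2 : ℝ)) * jap v ^ (-(2 : ℝ)) := by
      rw [← Real.rpow_add (jap_pos v)]; norm_num
    rw [h4]; ring
  · congr 1; ring
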